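/- arXiv:1809.07733 — 4 statements merged into one kernel-verified Lean document; each statement's English description precedes it below -/
import Mathlib

section
/- There is an absolute constant c₂ > 0 such that for all integers n ≥ 1 and k ≥ 1 there exists a polynomial P ∈ P_{n,k} with P(1) ≠ 0 and sup_{x∈[0,1]} |P′(x)|·√(1−x²) ≤ c₂ (n/k + 1)^{1/2} |P(1)|. -/
open Polynomial

/-- The truncation, at order `j`, of the expansion of `x^{-(n+1)}` in powers of `1 - x`. -/
noncomputable def truncInvPow (n j : ℕ) : ℝ[X] :=
  ∑ i ∈ Finset.range (j + 1), C ((n + i).choose i : ℝ) * (1 - X) ^ i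

lemma natDegree_truncInvPow_le (n j : ℕ) : (truncInvPow n j).natDegree ≤ j := by
  refine natDegree_sum_le_of_forall_le _ _ fun i hi => ?_
  have h1 : (1 - X : ℝ[X]).natDegree ≤ 1 :=
    (natDegree_sub_le _ _).trans (by simp)
  have h2 := natDegree_pow_le_of_le i h1
  have h3 := Finset.mem_range.1 hi
  refine (natDegree_C_mul_le _ _).trans (h2.trans ?_)
  omega

lemma eval_one_truncInvPow (n j : ℕ) : (truncInvPow n j).eval 1 = 1 := by
  simp [truncInvPow, eval_finsetSum, Finset.sum_range_succ']

lemma eval_derivative_X_pow_mul_truncInvPow (n j : ℕ) (x : ℝ) :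
    (derivative (X ^ (n + 1) * truncInvPow n j)).eval x =
      (n + 1) * (n + 1 + j).choose j * (1 - x) ^ j * x ^ n := by
  induction j with
  | zero => simp [truncInvPow]
  | succ j ih =>
    have hsucc : truncInvPow n (j + 1) = truncInvPow n j +
        C ((n + (j + 1)).choose (j + 1) : ℝ) * (1 - X) ^ (j + 1) := by
      rw [truncInvPow, Finset.sum_range_succ]; rfl
    have hpascal : ((n + 1 + (j + 1)).choose (j + 1) : ℝ) =
        (n + 1 + j).choose j + (n + (j + 1)).choose (j + 1) := by
      have := Nat.choose_succ_succ (n + 1 + j) j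
      rw [show n + (j + 1) = n + 1 + j by ring]
      exact_mod_cast this
    have habsorb : ((j : ℝ) + 1) * (n + (j + 1)).choose (j + 1) =
        (n + 1) * (n + 1 + j).choose j := by
      have := Nat.choose_succ_right_eq (n + 1 + j) j
      rw [show n + 1 + j - j = n + 1 by omega] at this
      rw [show n + (j + 1) = n + 1 + j by ring]
      have h : (((n + 1 + j).choose (j + 1) : ℕ) : ℝ) * (j + 1) =
        (n + 1 + j).choose j * (n + 1) := by exact_mod_cast this
      linarith
    rw [hsucc, mul_add, derivative_add, eval_add, ih, hpascal]
    simp only [derivative_mul, derivative_C, derivative_pow, derivative_sub,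
      derivative_one, derivative_X, eval_add, eval_mul, eval_pow, eval_X, eval_C, eval_sub,
      eval_one, eval_zero, Nat.cast_add, Nat.cast_one, Nat.add_sub_cancel]
    linear_combination (-(x ^ n * x * (1 - x) ^ j)) * habsorb

lemma sum_choose_mul_pow_mul_one_sub_pow_le_one (m k : ℕ) {u : ℝ} (h0 : 0 ≤ u) (h1 : u < 1) :
    (∑ j ∈ Finset.range k, ((m + j).choose j : ℝ) * u ^ j) * (1 - u) ^ (m + 1) ≤ 1 := by
  have hs := hasSum_choose_mul_geometric_of_norm_lt_one m
    (show ‖u‖ < 1 by rwa [Real.norm_of_nonneg h0])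
  have hle := sum_le_hasSum (Finset.range k) (fun i _ => by positivity) hs
  have hpos : 0 < (1 - u) ^ (m + 1) := pow_pos (by linarith) _
  rw [le_div_iff₀ hpos] at hle
  refine le_trans (le_of_eq ?_) hle
  congr 1
  refine Finset.sum_congr rfl fun j _ => ?_
  rw [add_comm j m, Nat.choose_symm_add]

/-- `u ↦ u^p (1-u)^q` is nonincreasing past its maximum point. -/
lemma pow_mul_one_sub_pow_le {p q : ℕ} {a u : ℝ} (ha0 : 0 < a) (ha1 : a < 1)
    (hpq : p / a ≤ q / (1 - a)) (hau : a ≤ u) (hu : u ≤ 1) :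
    u ^ p * (1 - u) ^ q ≤ a ^ p * (1 - a) ^ q := by
  have hb : 0 < 1 - a := by linarith
  have h1 : u ≤ a * Real.exp ((u - a) / a) := by
    have := Real.add_one_le_exp ((u - a) / a)
    calc u = a * ((u - a) / a + 1) := by field_simp; ring
      _ ≤ _ := by gcongr
  have h2 : 1 - u ≤ (1 - a) * Real.exp (-((u - a) / (1 - a))) := by
    have := Real.add_one_le_exp (-((u - a) / (1 - a)))
    calc 1 - u = (1 - a) * (-((u - a) / (1 - a)) + 1) := by field_simp; ring
      _ ≤ _ := by gcongr
  have hu0 : 0 ≤ 1 - u := by linarith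
  have hexp : (p : ℝ) * ((u - a) / a) + q * (-((u - a) / (1 - a))) ≤ 0 := by
    have := mul_le_mul_of_nonneg_right hpq (sub_nonneg.2 hau)
    calc _ = p / a * (u - a) - q / (1 - a) * (u - a) := by ring
      _ ≤ 0 := by linarith
  calc u ^ p * (1 - u) ^ q
      ≤ (a * Real.exp ((u - a) / a)) ^ p * ((1 - a) * Real.exp (-((u - a) / (1 - a)))) ^ q := by
        have : 0 ≤ u := ha0.le.trans hau
        gcongr
    _ = a ^ p * (1 - a) ^ q * Real.exp (p * ((u - a) / a) + q * (-((u - a) / (1 - a)))) := by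
        rw [Real.exp_add, Real.exp_nat_mul, Real.exp_nat_mul, mul_pow, mul_pow]; ring
    _ ≤ a ^ p * (1 - a) ^ q * 1 := by
        gcongr
        exact Real.exp_le_one_iff.2 hexp
    _ = _ := mul_one _

lemma sqrt_mul_pow_mul_one_sub_pow_le {n k j : ℕ} (hn : 1 ≤ n) (hjk : j < k) {u : ℝ}
    (hu : (k : ℝ) / (n + k) ≤ u) (hu1 : u ≤ 1) :
    √u * (u ^ j * (1 - u) ^ n) ≤
      √((k : ℝ) / (n + k)) * (((k : ℝ) / (n + k)) ^ j * (1 - (k : ℝ) / (n + k)) ^ n) := by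
  have hn' : (0 : ℝ) < n := by exact_mod_cast hn
  have hk' : (0 : ℝ) < k := by exact_mod_cast (by omega : 0 < k)
  have hjk' : (j : ℝ) + 1 ≤ k := by exact_mod_cast hjk
  have hone : 1 - (k : ℝ) / (n + k) = n / (n + k) := by field_simp; ring
  have ha0 : (0 : ℝ) < k / (n + k) := by positivity
  have hb0 : (0 : ℝ) < 1 - k / (n + k) := by rw [hone]; positivity
  have key := pow_mul_one_sub_pow_le (p := 2 * j + 1) (q := 2 * n) ha0 (by linarith) (by
    rw [hone]
    have e : ((2 * n : ℕ) : ℝ) / (n / (n + k)) = 2 * (n + k) := by push_cast; field_simp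
    rw [e, div_le_iff₀ ha0]
    push_cast
    have e2 : 2 * ((n : ℝ) + k) * (k / (n + k)) = 2 * k := by field_simp
    rw [e2]; linarith) hu hu1
  have hsq (v : ℝ) (hv : 0 ≤ v) :
      (√v * (v ^ j * (1 - v) ^ n)) ^ 2 = v ^ (2 * j + 1) * (1 - v) ^ (2 * n) := by
    rw [mul_pow, Real.sq_sqrt hv]; ring
  refine le_of_sq_le_sq ?_ (by positivity)
  rwa [hsq _ (ha0.le.trans hu), hsq _ ha0.le]

lemma sqrt_mul_sum_choose_le {n k : ℕ} (hk : 1 ≤ k) (hkn : k ≤ n) {u : ℝ}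
    (hu0 : 0 ≤ u) (hu1 : u ≤ 1) :
    √u * ∑ j ∈ Finset.range k, ((n + 1 + j).choose j : ℝ) * (u ^ j * (1 - u) ^ n) ≤
      4 * √((k : ℝ) / (n + k)) := by
  have hn' : (0 : ℝ) < n := by exact_mod_cast (by omega : 0 < n)
  have hkn' : (k : ℝ) ≤ n := by exact_mod_cast hkn
  have hhalf : (k : ℝ) / (n + k) ≤ 1 / 2 := by
    rw [div_le_div_iff₀ (by positivity) (by norm_num)]; linarith
  have small (v : ℝ) (hv0 : 0 ≤ v) (hv : v ≤ (k : ℝ) / (n + k)) :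
      √v * ∑ j ∈ Finset.range k, ((n + 1 + j).choose j : ℝ) * (v ^ j * (1 - v) ^ n) ≤
        4 * √((k : ℝ) / (n + k)) := by
    have hv2 : 1 / 2 ≤ 1 - v := by linarith
    have hgeom := sum_choose_mul_pow_mul_one_sub_pow_le_one (n + 1) k hv0 (by linarith)
    set S := ∑ j ∈ Finset.range k, ((n + 1 + j).choose j : ℝ) * (v ^ j * (1 - v) ^ n) with hS
    have hb : 0 ≤ 1 - v := by linarith
    have hS0 : 0 ≤ S := Finset.sum_nonneg fun j _ => by positivity
    have hS1 : S * (1 - v) ^ 2 ≤ 1 := by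
      refine le_trans (le_of_eq ?_) hgeom
      rw [hS, Finset.sum_mul, Finset.sum_mul]
      exact Finset.sum_congr rfl fun j _ => by ring
    have hS4 : S ≤ 4 := by nlinarith [mul_nonneg hS0 (by nlinarith : 0 ≤ (1 - v) ^ 2 - 1 / 4)]
    calc √v * S ≤ √((k : ℝ) / (n + k)) * 4 := by gcongr
      _ = _ := mul_comm _ _
  rcases le_total u ((k : ℝ) / (n + k)) with h | h
  · exact small u hu0 h
  · refine le_trans ?_ (small _ (by positivity) le_rfl)
    rw [Finset.mul_sum, Finset.mul_sum]
    refine Finset.sum_le_sum fun j hj => ?_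
    have := sqrt_mul_pow_mul_one_sub_pow_le (hk.trans hkn) (Finset.mem_range.1 hj) h hu1
    rw [mul_left_comm, mul_left_comm √((k : ℝ) / (n + k))]
    gcongr

lemma abs_derivative_mul_sqrt_le {n k : ℕ} (hk : 1 ≤ k) (hkn : k ≤ n) {x : ℝ}
    (hx0 : 0 ≤ x) (hx1 : x ≤ 1) :
    |(derivative (X ^ (n + 1) * ∑ j ∈ Finset.range k, truncInvPow n j)).eval x| * √(1 - x ^ 2) ≤
      16 * √((n : ℝ) / k) * k := by
  have hk' : (0 : ℝ) < k := by exact_mod_cast hk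
  have hn1 : (1 : ℝ) ≤ n := by exact_mod_cast hk.trans hkn
  have hsum := sqrt_mul_sum_choose_le hk hkn (sub_nonneg.2 hx1) (by linarith : 1 - x ≤ 1)
  set S := ∑ j ∈ Finset.range k, ((n + 1 + j).choose j : ℝ) * ((1 - x) ^ j * (1 - (1 - x)) ^ n)
    with hS
  have hderiv : (derivative (X ^ (n + 1) * ∑ j ∈ Finset.range k, truncInvPow n j)).eval x =
      (n + 1) * S := by
    rw [Finset.mul_sum, derivative_sum, eval_finsetSum, hS, Finset.mul_sum]
    refine Finset.sum_congr rfl fun j _ => ?_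
    rw [eval_derivative_X_pow_mul_truncInvPow, sub_sub_cancel]; ring
  have hu : 0 ≤ 1 - x := by linarith
  have hS0 : 0 ≤ S := Finset.sum_nonneg fun j _ => by
    rw [sub_sub_cancel]; positivity
  have hsqrt : √(1 - x ^ 2) ≤ 2 * √(1 - x) := by
    rw [Real.sqrt_le_left (by positivity), mul_pow, Real.sq_sqrt hu]
    nlinarith
  have hle : √((k : ℝ) / (n + k)) ≤ √((k : ℝ) / n) := by
    gcongr; linarith
  have hswap : (n : ℝ) * √((k : ℝ) / n) = √((n : ℝ) / k) * k := by
    rw [Real.sqrt_div hk'.le, Real.sqrt_div (by linarith)]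
    have h1 := Real.mul_self_sqrt hk'.le
    have h2 := Real.mul_self_sqrt (by linarith : (0 : ℝ) ≤ n)
    have h3 : 0 < √(k : ℝ) := by positivity
    have h4 : 0 < √(n : ℝ) := by positivity
    field_simp
    nlinarith
  rw [hderiv, abs_of_nonneg (by positivity)]
  calc (n + 1) * S * √(1 - x ^ 2) ≤ (n + 1) * S * (2 * √(1 - x)) := by gcongr
    _ = 2 * (n + 1) * (√(1 - x) * S) := by ring
    _ ≤ 2 * (n + n) * (4 * √((k : ℝ) / n)) := by
        refine mul_le_mul (by linarith) (by linarith) (by positivity) (by positivity)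
    _ = 16 * (n * √((k : ℝ) / n)) := by ring
    _ = _ := by rw [hswap]; ring

/-- There is an absolute constant `c₂ > 0` such that for all `n, k ≥ 1` there exists
`P ∈ 𝒫_{n,k}` with `P(1) ≠ 0` and
`sup_{x ∈ [0,1]} |P'(x)| √(1-x²) ≤ c₂ (n/k + 1)^(1/2) |P(1)|`. -/
theorem stmt_3 : ∃ c₂ : ℝ, 0 < c₂ ∧ ∀ n k : ℕ, 1 ≤ n → 1 ≤ k →
    ∃ P R : Polynomial ℝ, R.natDegree ≤ k - 1 ∧ P = X ^ (n + 1) * R ∧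
      P.eval 1 ≠ 0 ∧
      (⨆ x : Set.Icc (0:ℝ) 1,
          |(Polynomial.derivative P).eval (x : ℝ)| * Real.sqrt (1 - (x : ℝ) ^ 2)) ≤
        c₂ * Real.sqrt ((n : ℝ) / (k : ℝ) + 1) * |P.eval 1| := by
  refine ⟨16, by norm_num, fun n k hn hk => ?_⟩
  obtain ⟨l, hl1, hln, hlk, hratio⟩ : ∃ l : ℕ, 1 ≤ l ∧ l ≤ n ∧ l ≤ k ∧
      (n : ℝ) / l ≤ n / k + 1 := by
    rcases le_total k n with h | h
    · exact ⟨k, hk, h, le_rfl, by linarith⟩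
    · have : (n : ℝ) ≠ 0 := by positivity
      exact ⟨n, hn, le_rfl, h, by rw [div_self this]; linarith [show 0 ≤ (n : ℝ) / k by positivity]⟩
  have heval : (X ^ (n + 1) * ∑ j ∈ Finset.range l, truncInvPow n j).eval 1 = (l : ℝ) := by
    simp [eval_finsetSum, eval_one_truncInvPow]
  refine ⟨_, ∑ j ∈ Finset.range l, truncInvPow n j, ?_, rfl, ?_, ?_⟩
  · refine natDegree_sum_le_of_forall_le _ _ fun j hj => ?_
    have := Finset.mem_range.1 hj
    exact (natDegree_truncInvPow_le n j).trans (by omega)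
  · rw [heval]; positivity
  · have : Nonempty (Set.Icc (0 : ℝ) 1) := ⟨⟨0, by simp⟩⟩
    refine ciSup_le fun x => (abs_derivative_mul_sqrt_le hl1 hln x.2.1 x.2.2).trans ?_
    rw [heval, abs_of_nonneg (by positivity)]
    gcongr
end

section
/- Let n ≥ 1 and k ≥ 1 be integers, and let S(x) := x^n Q(x) √(1−x²), where Q is a real polynomial of degree at most k−1. Then for every x ∈ [0, 1 − 10k/n], one has |S(x)| ≤ x^{n/2} · ‖S‖_{[0,1]}. (If 1 − 10k/n < 0 the statement is vacuous.) -/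
open Polynomial

/-- Chebyshev polynomials of the first kind satisfy `T_m(z) ≤ (2z)^m` for `z ≥ 1`. -/
theorem eval_chebyshev_T_le_two_mul_pow (m : ℕ) {z : ℝ} (hz : 1 ≤ z) :
    (Chebyshev.T ℝ m).eval z ≤ (2 * z) ^ m := by
  obtain ⟨θ, hθ, rfl⟩ : ∃ θ : ℝ, 0 ≤ θ ∧ Real.cosh θ = z :=
    ⟨Real.arcosh z, Real.arcosh_nonneg hz, Real.cosh_arcosh hz⟩
  rw [Chebyshev.T_real_cosh]
  have hexp : Real.exp θ ≤ 2 * Real.cosh θ := by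
    rw [Real.cosh_eq]
    linarith [Real.exp_pos (-θ)]
  calc Real.cosh (((m : ℤ) : ℝ) * θ) ≤ Real.exp (m * θ) := by
        rw [Int.cast_natCast, Real.cosh_eq]
        have : Real.exp (-(m * θ)) ≤ Real.exp (m * θ) := by
          apply Real.exp_le_exp.mpr
          have : 0 ≤ (m : ℝ) * θ := by positivity
          linarith
        linarith
    _ = Real.exp θ ^ m := Real.exp_nat_mul θ m
    _ ≤ (2 * Real.cosh θ) ^ m := by gcongr

/-- Growth of a polynomial of degree at most `m`, bounded on `[1 - h, 1]`, to the left of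
this interval. -/
theorem eval_one_sub_le_of_forall_abs_le {m : ℕ} {P : ℝ[X]} (hP : P.natDegree ≤ m)
    {B h s : ℝ} (hh : 0 < h) (hs : h ≤ s)
    (hB : ∀ t ∈ Set.Icc (1 - h) 1, |P.eval t| ≤ B) :
    P.eval (1 - s) ≤ B * (4 * s / h) ^ m := by
  have hs0 : 0 < s := hh.trans_le hs
  have hC : 0 < (4 * s / h) ^ m := by positivity
  rw [← div_le_iff₀ hC]
  refine le_of_forall_gt_imp_ge_of_dense fun D hD ↦ ?_
  have hB0 : 0 ≤ B := (abs_nonneg _).trans (hB 1 ⟨by linarith, le_rfl⟩)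
  have hD0 : 0 < D := hB0.trans_lt hD
  set L : ℝ[X] := C (-(h / 2)) * X + C (1 - h / 2) with hL
  set R : ℝ[X] := C D⁻¹ * P.comp L with hR
  have hReval (z : ℝ) : R.eval z = D⁻¹ * P.eval (1 - h * (1 + z) / 2) := by
    simp only [hR, hL, eval_mul, eval_C, eval_comp, eval_add, eval_X]
    ring_nf
  have hRdeg : R.degree ≤ m := by
    apply degree_le_of_natDegree_le
    calc R.natDegree ≤ (P.comp L).natDegree := natDegree_C_mul_le _ _
      _ ≤ P.natDegree * L.natDegree := natDegree_comp_le
      _ ≤ P.natDegree * 1 := Nat.mul_le_mul_left _ natDegree_linear_le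
      _ ≤ m := by simpa using hP
  have hRbd : ∀ z ∈ Set.Icc (-1 : ℝ) 1, |R.eval z| ≤ 1 := by
    rintro z ⟨hz1, hz2⟩
    rw [hReval, abs_mul, abs_of_pos (inv_pos.mpr hD0), inv_mul_le_iff₀ hD0, mul_one]
    exact (hB _ ⟨by nlinarith, by nlinarith⟩).trans hD.le
  have hsh : 1 ≤ s / h := (one_le_div hh).mpr hs
  have hz : 1 ≤ 2 * (s / h) - 1 := by linarith
  have key := Chebyshev.eval_iterate_derivative_le_of_forall_abs_le_one (k := 0) hz hRdeg hRbd
  have hpt : 1 - h * (1 + (2 * (s / h) - 1)) / 2 = 1 - s := by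
    field_simp
    ring
  simp only [Function.iterate_zero, id_eq, hReval, hpt] at key
  rw [div_le_iff₀ hC, ← inv_mul_le_iff₀ hD0]
  refine key.trans ((eval_chebyshev_T_le_two_mul_pow m hz).trans ?_)
  apply pow_le_pow_left₀ (by linarith)
  rw [mul_div_assoc]
  linarith

theorem exp_one_mul_le_exp_half {y : ℝ} (hy : 10 ≤ y) :
    Real.exp 1 * (4.4 * y) ≤ Real.exp (y / 2) := by
  have h4 : (54 : ℝ) ≤ Real.exp 4 := by
    have he : (2.718 : ℝ) ≤ Real.exp 1 := by linarith [Real.exp_one_gt_d9]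
    calc (54 : ℝ) ≤ 2.718 ^ 4 := by norm_num
      _ ≤ Real.exp 1 ^ 4 := by gcongr
      _ = Real.exp 4 := by rw [← Real.exp_nat_mul]; norm_num
  have h5 : y / 2 - 4 ≤ Real.exp (y / 2 - 5) := by
    linarith [Real.add_one_le_exp (y / 2 - 5)]
  have hsplit : Real.exp (y / 2) = Real.exp 1 * (Real.exp 4 * Real.exp (y / 2 - 5)) := by
    rw [← Real.exp_add, ← Real.exp_add]
    ring_nf
  rw [hsplit]
  refine mul_le_mul_of_nonneg_left ?_ (Real.exp_pos 1).le
  nlinarith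

/-- Let `n ≥ 1` and `k ≥ 1` be integers, and let `S(x) := x^n Q(x) √(1-x²)` with `Q`
a real polynomial of degree at most `k-1`. Then for every `x ∈ [0, 1 - 10k/n]`,
`|S(x)| ≤ x^(n/2) ‖S‖_{[0,1]}`. -/
theorem stmt_8 (n k : ℕ) (hn : 1 ≤ n) (hk : 1 ≤ k) (Q : Polynomial ℝ)
    (hQ : Q.natDegree ≤ k - 1) (x : ℝ)
    (hx : x ∈ Set.Icc (0:ℝ) (1 - 10 * (k : ℝ) / (n : ℝ))) :
    |x ^ n * Q.eval x * Real.sqrt (1 - x ^ 2)| ≤ x ^ ((n : ℝ) / 2) *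
      ⨆ t : Set.Icc (0:ℝ) 1,
        |(t : ℝ) ^ n * Q.eval (t : ℝ) * Real.sqrt (1 - (t : ℝ) ^ 2)| := by
  obtain ⟨hx0, hx1⟩ := hx
  have hn0 : (0 : ℝ) < n := by exact_mod_cast hn
  have hk0 : (0 : ℝ) < k := by exact_mod_cast hk
  set M : ℝ := ⨆ t : Set.Icc (0:ℝ) 1,
    |(t : ℝ) ^ n * Q.eval (t : ℝ) * Real.sqrt (1 - (t : ℝ) ^ 2)| with hM
  have hM0 : 0 ≤ M := Real.iSup_nonneg fun _ ↦ abs_nonneg _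
  have hbdd : BddAbove (Set.range fun t : Set.Icc (0:ℝ) 1 ↦
      |(t : ℝ) ^ n * Q.eval (t : ℝ) * Real.sqrt (1 - (t : ℝ) ^ 2)|) := by
    refine (isCompact_range ?_).bddAbove
    have := Q.continuous
    fun_prop
  have hle : ∀ t ∈ Set.Icc (0:ℝ) 1, |t ^ n * Q.eval t * Real.sqrt (1 - t ^ 2)| ≤ M :=
    fun t ht ↦ le_ciSup hbdd ⟨t, ht⟩
  set R : ℝ[X] := (1 - X ^ 2) * Q ^ 2 with hR
  have hsq : ∀ t ∈ Set.Icc (0:ℝ) 1,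
      (t ^ n * Q.eval t * Real.sqrt (1 - t ^ 2)) ^ 2 = (t ^ n) ^ 2 * R.eval t := by
    rintro t ⟨ht0, ht1⟩
    have : 0 ≤ 1 - t ^ 2 := by nlinarith
    rw [mul_pow, Real.sq_sqrt this]
    simp only [hR, eval_mul, eval_sub, eval_one, eval_pow, eval_X]
    ring
  have hRdeg : R.natDegree ≤ 2 * k := by
    have h1 : (1 - X ^ 2 : ℝ[X]).natDegree ≤ 2 := by compute_degree
    have h2 : (Q ^ 2).natDegree ≤ 2 * (k - 1) :=
      natDegree_pow_le.trans (Nat.mul_le_mul_left 2 hQ)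
    have h3 : R.natDegree ≤ _ := natDegree_mul_le
    omega
  set u : ℝ := k / n with hu
  have hu0 : 0 < u := by positivity
  have hxu : x ≤ 1 - 10 * u := by rwa [hu, ← mul_div_assoc]
  set h : ℝ := 1 - Real.exp (-u) with hh
  have hhu : h ≤ u := by linarith [Real.add_one_le_exp (-u)]
  have huh : u ≤ 1.1 * h := by
    have h1 : Real.exp (-u) * (1 + u) ≤ 1 := by
      calc Real.exp (-u) * (1 + u) ≤ Real.exp (-u) * Real.exp u := by
            gcongr
            linarith [Real.add_one_le_exp u]
        _ = 1 := by rw [← Real.exp_add]; simp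
    nlinarith
  have hh0 : 0 < h := by linarith
  have hexp : Real.exp (-u) ^ n = Real.exp (-k) := by
    rw [← Real.exp_nat_mul, hu]
    congr 1
    field_simp
  have hB : ∀ t ∈ Set.Icc (1 - h) 1, |R.eval t| ≤ (M * Real.exp k) ^ 2 := by
    rintro t ⟨ht0, ht1⟩
    have hta : Real.exp (-u) ≤ t := by linarith
    have ht : t ∈ Set.Icc (0:ℝ) 1 := ⟨(Real.exp_pos _).le.trans hta, ht1⟩
    have hR0 : 0 ≤ R.eval t := by
      have : 0 ≤ 1 - t ^ 2 := by nlinarith [ht.1]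
      simp only [hR, eval_mul, eval_sub, eval_one, eval_pow, eval_X]
      positivity
    have htn : Real.exp (-k) ≤ t ^ n := by
      rw [← hexp]
      gcongr
    have hone : 1 ≤ Real.exp k * t ^ n := by
      calc (1 : ℝ) = Real.exp k * Real.exp (-k) := by rw [← Real.exp_add]; simp
        _ ≤ _ := by gcongr
    rw [abs_of_nonneg hR0]
    calc R.eval t ≤ (Real.exp k * t ^ n) ^ 2 * R.eval t :=
          le_mul_of_one_le_left hR0 (one_le_pow₀ hone)
      _ = Real.exp k ^ 2 * |t ^ n * Q.eval t * Real.sqrt (1 - t ^ 2)| ^ 2 := by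
          rw [sq_abs, hsq t ht]; ring
      _ ≤ Real.exp k ^ 2 * M ^ 2 := by gcongr; exact hle t ht
      _ = _ := by ring
  set s : ℝ := 1 - x with hs
  have hsu : 10 * u ≤ s := by linarith
  have hgrow := eval_one_sub_le_of_forall_abs_le hRdeg hh0 (by linarith : h ≤ s) hB
  rw [show 1 - s = x by simp [hs]] at hgrow
  have hxn : x ^ n ≤ Real.exp (-(n * s)) := by
    calc x ^ n ≤ Real.exp (-s) ^ n := by
          gcongr
          linarith [Real.add_one_le_exp (-s)]
      _ = _ := by rw [← Real.exp_nat_mul]; ring_nf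
  have hbase : Real.exp 1 * (4 * s / h) ≤ Real.exp (s / u / 2) := by
    refine le_trans ?_ (exp_one_mul_le_exp_half ((le_div_iff₀ hu0).mpr hsu))
    gcongr
    rw [div_le_iff₀ hh0, ← mul_div_assoc, div_mul_eq_mul_div, le_div_iff₀ hu0]
    nlinarith
  have hfac : Real.exp k ^ 2 * (4 * s / h) ^ (2 * k) * x ^ n ≤ 1 := by
    have hs0 : 0 < s := by linarith
    calc Real.exp k ^ 2 * (4 * s / h) ^ (2 * k) * x ^ n
        = (Real.exp 1 * (4 * s / h)) ^ (2 * k) * x ^ n := by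
          rw [mul_pow, ← Real.exp_nat_mul, ← Real.exp_nat_mul]
          push_cast
          ring_nf
      _ ≤ Real.exp (s / u / 2) ^ (2 * k) * Real.exp (-(n * s)) := by gcongr
      _ = 1 := by
          rw [← Real.exp_nat_mul, ← Real.exp_add, Real.exp_eq_one_iff, hu]
          push_cast
          field_simp
          ring
  have hpow : (x ^ ((n : ℝ) / 2)) ^ 2 = x ^ n := by
    rw [← Real.rpow_natCast, ← Real.rpow_mul hx0, ← Real.rpow_natCast]
    norm_num
  have hpos : 0 ≤ x ^ ((n : ℝ) / 2) := Real.rpow_nonneg hx0 _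
  refine abs_le_of_sq_le_sq ?_ (mul_nonneg hpos hM0)
  rw [hsq x ⟨hx0, by linarith⟩, mul_pow, hpow]
  calc (x ^ n) ^ 2 * R.eval x
      ≤ (x ^ n) ^ 2 * ((M * Real.exp k) ^ 2 * (4 * s / h) ^ (2 * k)) := by gcongr
    _ = x ^ n * M ^ 2 * (Real.exp k ^ 2 * (4 * s / h) ^ (2 * k) * x ^ n) := by ring
    _ ≤ x ^ n * M ^ 2 * 1 := by gcongr
    _ = x ^ n * M ^ 2 := mul_one _
end

section
/- There is an absolute constant c₄ > 0 with the following property. Let 1 ≤ κ ≤ ν−1 be integers and let T be the Chebyshev polynomial for the Müntz space span{x^ν, x^{ν+1}, …, x^{ν+κ}} on [0,1] normalized so that T(1) = 1; that is, T(x) = x^ν Q(x) with Q a real polynomial of degree at most κ, ‖T‖_{[0,1]} = 1, and there exist points 1 = x_0 > x_1 > … > x_κ > 0 with T(x_j) = (−1)^j for j = 0, 1, …, κ. Denote the zeros of T in (0,1) by β_1 > β_2 > … > β_κ. Then β_j ≤ 1 − c₄ j²/((ν+κ)κ) for each j = 1, …, κ. -/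
open Polynomial

/-- Bernoulli's inequality raised to a power: the polynomial `(1 - (ν/κ) u) ^ κ` lies below
`(1 - u) ^ ν` as long as its base is nonnegative. -/
lemma one_sub_div_mul_pow_le_one_sub_pow {κ ν : ℕ} (hκ : 0 < κ) (hκν : κ ≤ ν) {u : ℝ} (hu : u ≤ 1)
    (h : 0 ≤ 1 - (ν / κ : ℝ) * u) : (1 - (ν / κ : ℝ) * u) ^ κ ≤ (1 - u) ^ ν := by
  have hκ' : (0 : ℝ) < κ := by exact_mod_cast hκ
  have hp : (1 : ℝ) ≤ (ν : ℝ) / κ := by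
    rw [le_div_iff₀ hκ', one_mul]
    exact_mod_cast hκν
  have hb := one_add_mul_self_le_rpow_one_add (s := -u) (by linarith) hp
  have hle : 1 - (ν / κ : ℝ) * u ≤ (1 - u) ^ (ν / κ : ℝ) := by
    rw [← sub_eq_add_neg] at hb
    linarith
  calc (1 - (ν / κ : ℝ) * u) ^ κ ≤ ((1 - u) ^ (ν / κ : ℝ)) ^ κ := pow_le_pow_left₀ h hle κ
    _ = (1 - u) ^ ν := by
      rw [← Real.rpow_mul_natCast (by linarith), div_mul_cancel₀ _ hκ'.ne', Real.rpow_natCast]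

lemma one_add_sq_div_two_le_cosh {θ : ℝ} (hθ : 0 ≤ θ) : 1 + θ ^ 2 / 2 ≤ Real.cosh θ := by
  have h1 : Real.cosh θ = 1 + 2 * Real.sinh (θ / 2) ^ 2 := by
    have := Real.cosh_two_mul (θ / 2)
    rw [mul_div_cancel₀ _ (two_ne_zero' ℝ), Real.cosh_sq] at this
    linarith
  have h2 : θ / 2 ≤ Real.sinh (θ / 2) := Real.self_le_sinh_iff.2 (by linarith)
  nlinarith

/-- Growth to the right of `1` of a polynomial `Q` with `x ^ ν * Q x` bounded by `1` on `[0,1]`. -/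
lemma eval_le_exp_of_abs_pow_mul_eval_le_one {ν κ : ℕ} (hκ : 0 < κ) (hκν : κ ≤ ν) {Q : ℝ[X]}
    (hdeg : Q.natDegree ≤ κ) (hbd : ∀ x ∈ Set.Icc (0 : ℝ) 1, |x ^ ν * Q.eval x| ≤ 1) {θ : ℝ}
    (hθ : 0 ≤ θ) (hpos : 0 ≤ Q.eval (1 + (κ / ν : ℝ) / 2 * (Real.cosh θ - 1))) :
    Q.eval (1 + (κ / ν : ℝ) / 2 * (Real.cosh θ - 1)) ≤ Real.exp (2 * κ * θ) := by
  have hκ' : (0 : ℝ) < κ := by exact_mod_cast hκ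
  have hκν' : (κ : ℝ) ≤ ν := by exact_mod_cast hκν
  have hν' : (0 : ℝ) < ν := hκ'.trans_le hκν'
  set L : ℝ := κ / ν with hL
  have hL0 : 0 < L := by positivity
  have hL1 : L ≤ 1 := (div_le_one hν').2 hκν'
  let P : ℝ[X] := (C (1 / 2) * (X + 1)) ^ κ * Q.comp (1 + C (L / 2) * (X - 1))
  have hPe (y : ℝ) : P.eval y = ((1 + y) / 2) ^ κ * Q.eval (1 + L / 2 * (y - 1)) := by
    simp only [P, eval_mul, eval_pow, eval_C, eval_add, eval_X, eval_one, eval_comp, eval_sub]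
    ring_nf
  have hPdeg : P.degree ≤ ((2 * κ : ℕ) : WithBot ℕ) := by
    apply natDegree_le_iff_degree_le.1
    have h1 : ((C (1 / 2 : ℝ) * (X + 1)) ^ κ).natDegree ≤ κ := by
      have : (C (1 / 2 : ℝ) * (X + 1)).natDegree ≤ 1 := by compute_degree
      simpa using natDegree_pow_le_of_le κ this
    have h2 : (Q.comp (1 + C (L / 2) * (X - 1))).natDegree ≤ κ := by
      have h3 : (1 + C (L / 2) * (X - 1) : ℝ[X]).natDegree ≤ 1 := by compute_degree
      calc _ ≤ Q.natDegree * (1 + C (L / 2) * (X - 1) : ℝ[X]).natDegree := natDegree_comp_le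
        _ ≤ κ * 1 := Nat.mul_le_mul hdeg h3
        _ = κ := mul_one κ
    exact (natDegree_mul_le_of_le h1 h2).trans (by omega)
  have hPbd : ∀ y ∈ Set.Icc (-1 : ℝ) 1, |P.eval y| ≤ 1 := by
    rintro y ⟨hy1, hy2⟩
    set u := L / 2 * (1 - y) with hu
    have hx : 1 + L / 2 * (y - 1) = 1 - u := by rw [hu]; ring
    have hu0 : 0 ≤ u := by
      have : 0 ≤ 1 - y := by linarith
      positivity
    have hu1 : u ≤ 1 := by rw [hu]; nlinarith
    have hbase : (1 + y) / 2 = 1 - (ν / κ : ℝ) * u := by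
      rw [hu, hL]
      field_simp
      ring
    have hbase0 : 0 ≤ (1 + y) / 2 := by linarith
    have hG := one_sub_div_mul_pow_le_one_sub_pow hκ hκν hu1 (hbase ▸ hbase0)
    rw [← hbase] at hG
    rw [hPe, hx, abs_mul, abs_of_nonneg (pow_nonneg hbase0 κ)]
    have := hbd (1 - u) ⟨by linarith, by linarith⟩
    rw [abs_mul, abs_of_nonneg (pow_nonneg (by linarith) ν)] at this
    exact (mul_le_mul_of_nonneg_right hG (abs_nonneg _)).trans this
  have hcosh := Real.one_le_cosh θ
  have hmain := Polynomial.Chebyshev.eval_iterate_derivative_le_of_forall_abs_le_one (k := 0)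
    hcosh hPdeg hPbd
  simp only [Function.iterate_zero, id_eq, Chebyshev.T_real_cosh, hPe] at hmain
  push_cast at hmain
  have h1 : (1 : ℝ) ≤ ((1 + Real.cosh θ) / 2) ^ κ := one_le_pow₀ (by linarith)
  calc _ ≤ ((1 + Real.cosh θ) / 2) ^ κ * Q.eval (1 + L / 2 * (Real.cosh θ - 1)) :=
        le_mul_of_one_le_left hpos h1
    _ ≤ Real.cosh (2 * κ * θ) := hmain
    _ ≤ Real.exp (2 * κ * θ) := by
      rw [← Real.cosh_add_sinh]
      linarith [Real.sinh_nonneg_iff.2 (show 0 ≤ 2 * κ * θ by positivity)]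

/-- A polynomial of degree at most `#s` vanishing at `#s` points below `1`, normalized at `1`. -/
lemma eval_one_add_eq_prod {ι : Type*} {s : Finset ι} {β : ι → ℝ} (hinj : Set.InjOn β s)
    {Q : ℝ[X]} (hdeg : Q.natDegree ≤ s.card) (hroot : ∀ i ∈ s, Q.eval (β i) = 0)
    (hlt : ∀ i ∈ s, β i < 1) (h1 : Q.eval 1 = 1) (ρ : ℝ) :
    Q.eval (1 + ρ) = ∏ i ∈ s, (1 + ρ / (1 - β i)) := by
  have hdvd : ∏ i ∈ s, (X - C (β i)) ∣ Q := by
    refine Finset.prod_dvd_of_coprime (fun i hi k hk hik => ?_)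
      fun i hi => dvd_iff_isRoot.2 (hroot i hi)
    exact isCoprime_X_sub_C_of_isUnit_sub (sub_ne_zero.2 fun h => hik (hinj hi hk h)).isUnit
  obtain ⟨S, hS⟩ := hdvd
  have hR : (∏ i ∈ s, (X - C (β i))).Monic := monic_prod_X_sub_C _ _
  have hS0 : S ≠ 0 := by
    rintro rfl
    simp [hS] at h1
  have hSdeg : S.natDegree = 0 := by
    rw [hS, hR.natDegree_mul' hS0, natDegree_finsetProd_X_sub_C_eq_card] at hdeg
    omega
  obtain ⟨A, rfl⟩ := natDegree_eq_zero.1 hSdeg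
  have he (x : ℝ) : Q.eval x = (∏ i ∈ s, (x - β i)) * A := by
    simp [hS, eval_prod]
  rw [he] at h1
  have hprod : ∏ i ∈ s, (1 + ρ - β i) =
      (∏ i ∈ s, (1 + ρ / (1 - β i))) * ∏ i ∈ s, (1 - β i) := by
    rw [← Finset.prod_mul_distrib]
    refine Finset.prod_congr rfl fun i hi => ?_
    have : 1 - β i ≠ 0 := (sub_pos.2 (hlt i hi)).ne'
    field_simp
    ring
  rw [he, hprod, mul_assoc, h1, mul_one]

/-- There is an absolute constant `c₄ > 0` such that for integers `1 ≤ κ ≤ ν - 1`,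
if `T` is the Chebyshev polynomial of the Müntz space `span{x^ν, …, x^(ν+κ)}` on
`[0,1]` normalized so `T(1) = 1` (i.e. `T = x^ν Q` with `deg Q ≤ κ`,
`‖T‖_{[0,1]} = 1`, and `T` equioscillates at points `1 = x_0 > … > x_κ > 0`), and
its zeros in `(0,1)` are `β_1 > … > β_κ`, then `β_j ≤ 1 - c₄ j²/((ν+κ)κ)`. -/
theorem stmt_11 : ∃ c₄ : ℝ, 0 < c₄ ∧ ∀ ν κ : ℕ, 1 ≤ κ → κ + 1 ≤ ν →
    ∀ T Q : Polynomial ℝ, Q.natDegree ≤ κ → T = X ^ ν * Q → T.eval 1 = 1 →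
    (⨆ x : Set.Icc (0:ℝ) 1, |T.eval (x : ℝ)|) = 1 →
    (∃ x : ℕ → ℝ, x 0 = 1 ∧ (∀ i j : ℕ, i < j → j ≤ κ → x j < x i) ∧ 0 < x κ ∧
      ∀ j ≤ κ, T.eval (x j) = (-1 : ℝ) ^ j) →
    ∀ β : ℕ → ℝ, (∀ i j : ℕ, 1 ≤ i → i < j → j ≤ κ → β j < β i) →
      (∀ j : ℕ, 1 ≤ j → j ≤ κ → β j ∈ Set.Ioo (0:ℝ) 1 ∧ T.eval (β j) = 0) →
      ∀ j : ℕ, 1 ≤ j → j ≤ κ →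
        β j ≤ 1 - c₄ * (j : ℝ) ^ 2 / (((ν : ℝ) + (κ : ℝ)) * (κ : ℝ)) := by
  refine ⟨1 / 32, by norm_num, ?_⟩
  intro ν κ hκ hκν T Q hdeg hT hT1 hsup _ β hβ hzero j hj1 hjκ
  have hQ1 : Q.eval 1 = 1 := by simpa [hT] using hT1
  have hbd : ∀ x ∈ Set.Icc (0 : ℝ) 1, |x ^ ν * Q.eval x| ≤ 1 := by
    intro x hx
    have hbdd : BddAbove (Set.range fun x : Set.Icc (0 : ℝ) 1 => |T.eval (x : ℝ)|) :=
      (isCompact_range (by fun_prop)).bddAbove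
    have := le_ciSup hbdd ⟨x, hx⟩
    rw [hsup] at this
    simpa [hT] using this
  have hroot : ∀ i ∈ Finset.Icc 1 κ, Q.eval (β i) = 0 := by
    intro i hi
    obtain ⟨hi1, hi2⟩ := Finset.mem_Icc.1 hi
    obtain ⟨hmem, h0⟩ := hzero i hi1 hi2
    simpa [hT, hmem.1.ne'] using h0
  have hlt : ∀ i ∈ Finset.Icc 1 κ, β i < 1 := fun i hi =>
    (hzero i (Finset.mem_Icc.1 hi).1 (Finset.mem_Icc.1 hi).2).1.2
  have hanti : StrictAntiOn β (Finset.Icc 1 κ : Finset ℕ) := fun i hi k hk hik =>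
    hβ i k (Finset.mem_Icc.1 hi).1 hik (Finset.mem_Icc.1 hk).2
  have hjmem : j ∈ Finset.Icc 1 κ := Finset.mem_Icc.2 ⟨hj1, hjκ⟩
  have hκ' : (0 : ℝ) < κ := by exact_mod_cast hκ
  have hν' : (0 : ℝ) < ν := by exact_mod_cast (by omega : 0 < ν)
  have hj' : (0 : ℝ) < j := by exact_mod_cast hj1
  set θ : ℝ := j / (2 * κ) with hθ
  have hθ0 : 0 ≤ θ := by positivity
  set ρ : ℝ := (κ / ν : ℝ) / 2 * (Real.cosh θ - 1) with hρ
  have hcosh := one_add_sq_div_two_le_cosh hθ0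
  have hρ_ge : (j : ℝ) ^ 2 / (16 * (ν * κ)) ≤ ρ := by
    calc (j : ℝ) ^ 2 / (16 * (ν * κ)) = (κ / ν : ℝ) / 2 * (θ ^ 2 / 2) := by
          rw [hθ]
          field_simp
          norm_num
      _ ≤ ρ := mul_le_mul_of_nonneg_left (by linarith) (by positivity)
  have hρ0 : 0 < ρ := lt_of_lt_of_le (by positivity) hρ_ge
  have hδ : 0 < 1 - β j := sub_pos.2 (hlt j hjmem)
  have hfac : ∀ i ∈ Finset.Icc 1 κ, 1 ≤ 1 + ρ / (1 - β i) := fun i hi => by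
    have := sub_pos.2 (hlt i hi)
    have : 0 < ρ / (1 - β i) := by positivity
    linarith
  have hval := eval_one_add_eq_prod hanti.injOn (by simpa using hdeg) hroot hlt hQ1 ρ
  have hlow : (1 + ρ / (1 - β j)) ^ j ≤ Q.eval (1 + ρ) := by
    have hsub : Finset.Icc 1 j ⊆ Finset.Icc 1 κ := Finset.Icc_subset_Icc_right hjκ
    calc (1 + ρ / (1 - β j)) ^ j = ∏ i ∈ Finset.Icc 1 j, (1 + ρ / (1 - β j)) := by simp
      _ ≤ ∏ i ∈ Finset.Icc 1 j, (1 + ρ / (1 - β i)) := by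
        refine Finset.prod_le_prod (fun i _ => by linarith [hfac j hjmem]) fun i hi => ?_
        have h1 := hanti.antitoneOn (hsub hi) hjmem (Finset.mem_Icc.1 hi).2
        have h2 := sub_pos.2 (hlt i (hsub hi))
        gcongr
      _ ≤ ∏ i ∈ Finset.Icc 1 κ, (1 + ρ / (1 - β i)) :=
        Finset.prod_le_prod_of_subset_of_one_le hsub
          (fun i hi => by linarith [hfac i (hsub hi)]) fun i hi _ => hfac i hi
      _ = Q.eval (1 + ρ) := hval.symm
  have hup := eval_le_exp_of_abs_pow_mul_eval_le_one hκ (by omega) hdeg hbd hθ0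
    ((pow_nonneg (by linarith [hfac j hjmem]) j).trans hlow)
  have hexp : Real.exp (2 * κ * θ) = Real.exp 1 ^ j := by
    rw [← Real.exp_nat_mul, hθ]
    congr 1
    field_simp
  have hle : 1 + ρ / (1 - β j) ≤ Real.exp 1 :=
    le_of_pow_le_pow_left₀ (by omega) (Real.exp_pos 1).le (hlow.trans (hup.trans_eq hexp))
  have hρδ : ρ ≤ 2 * (1 - β j) := by
    rw [← div_le_iff₀ hδ]
    linarith [Real.exp_one_lt_three]
  have hfin : 1 / 32 * (j : ℝ) ^ 2 / ((ν + κ) * κ) ≤ (j : ℝ) ^ 2 / (16 * (ν * κ)) / 2 := by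
    rw [div_div, div_mul_eq_mul_div, div_div, one_mul]
    refine div_le_div_of_nonneg_left (by positivity) (by positivity) ?_
    nlinarith
  linarith
end

section
/- There is an absolute constant c₅ > 0 with the following property. Let κ ≥ 2 and ν ≥ 20κ be integers and let T be the Chebyshev polynomial for the Müntz space span{x^ν, x^{ν+1}, …, x^{ν+κ}} on [0,1] normalized so that T(1) = 1; that is, T(x) = x^ν Q(x) with Q a real polynomial of degree at most κ, ‖T‖_{[0,1]} = 1, and there exist points 1 = x_0 > x_1 > … > x_κ > 0 with T(x_j) = (−1)^j for j = 0, 1, …, κ. Then ∫_0^1 T(u)² du ≥ c₅ κ/ν. -/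
open Polynomial

/-- The self-reciprocal polynomial function `z ^ n * p ((z + z⁻¹) / 2)`, extended to `z = 0`. -/
noncomputable def joukowskiLift (p : ℝ[X]) (n : ℕ) (z : ℂ) : ℂ :=
  ∑ k ∈ Finset.range (n + 1), (p.coeff k : ℂ) * ((z ^ 2 + 1) / 2) ^ k * z ^ (n - k)

lemma differentiable_joukowskiLift (p : ℝ[X]) (n : ℕ) :
    Differentiable ℂ (joukowskiLift p n) := by
  unfold joukowskiLift
  fun_prop

lemma joukowskiLift_eq {p : ℝ[X]} {n : ℕ} (hp : p.natDegree ≤ n) {z : ℂ} (hz : z ≠ 0) :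
    joukowskiLift p n z = z ^ n * (p.map Complex.ofRealHom).eval ((z + z⁻¹) / 2) := by
  have hdeg : (p.map Complex.ofRealHom).natDegree < n + 1 :=
    lt_of_le_of_lt natDegree_map_le (Nat.lt_succ_of_le hp)
  rw [eval_eq_sum_range' hdeg, Finset.mul_sum, joukowskiLift]
  refine Finset.sum_congr rfl fun k hk => ?_
  have hk : k ≤ n := Nat.lt_succ_iff.mp (Finset.mem_range.mp hk)
  have hsplit : z ^ n = z ^ k * z ^ (n - k) := by rw [← pow_add, Nat.add_sub_cancel' hk]
  have hbase : (z ^ 2 + 1) / 2 = z * ((z + z⁻¹) / 2) := by field_simp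
  rw [hsplit, hbase, mul_pow, coeff_map]
  simp only [Complex.ofRealHom_eq_coe]
  ring

lemma joukowskiLift_exp {p : ℝ[X]} {n : ℕ} (hp : p.natDegree ≤ n) (θ : ℝ) :
    joukowskiLift p n (Complex.exp (θ * Complex.I)) =
      Complex.exp (θ * Complex.I) ^ n * (p.eval (Real.cos θ) : ℝ) := by
  rw [joukowskiLift_eq hp (Complex.exp_ne_zero _)]
  have hcos : (Complex.exp (θ * Complex.I) + (Complex.exp (θ * Complex.I))⁻¹) / 2 =
      Complex.ofRealHom (Real.cos θ) := by
    simp [Complex.cos, ← Complex.exp_neg]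
  rw [hcos, eval_map_apply]
  simp

lemma norm_joukowskiLift_le_one {p : ℝ[X]} {n : ℕ} (hp : p.natDegree ≤ n)
    (hb : ∀ x ∈ Set.Icc (-1 : ℝ) 1, |p.eval x| ≤ 1) {z : ℂ} (hz : ‖z‖ ≤ 1) :
    ‖joukowskiLift p n z‖ ≤ 1 := by
  refine Complex.norm_le_of_forall_mem_frontier_norm_le (U := Metric.ball 0 1)
    Metric.isBounded_ball (differentiable_joukowskiLift p n).diffContOnCl ?_ ?_
  · intro w hw
    rw [frontier_ball _ one_ne_zero, mem_sphere_zero_iff_norm] at hw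
    have hw' : Complex.exp (w.arg * Complex.I) = w := by
      simpa [hw] using Complex.norm_mul_exp_arg_mul_I w
    rw [← hw', joukowskiLift_exp hp, norm_mul, norm_pow, Complex.norm_exp_ofReal_mul_I,
      one_pow, one_mul, Complex.norm_real]
    exact hb _ (Real.cos_mem_Icc _)
  · rw [closure_ball _ one_ne_zero]
    simpa using hz

lemma norm_joukowskiLift_le_pow {p : ℝ[X]} {n : ℕ} (hp : p.natDegree ≤ n)
    (hb : ∀ x ∈ Set.Icc (-1 : ℝ) 1, |p.eval x| ≤ 1) {z : ℂ} (hz : 1 ≤ ‖z‖) :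
    ‖joukowskiLift p n z‖ ≤ ‖z‖ ^ (2 * n) := by
  have hz0 : z ≠ 0 := norm_pos_iff.mp (by linarith)
  have hrefl : joukowskiLift p n z = z ^ (2 * n) * joukowskiLift p n z⁻¹ := by
    rw [joukowskiLift_eq hp hz0, joukowskiLift_eq hp (inv_ne_zero hz0), inv_inv, add_comm z⁻¹ z,
      ← mul_assoc, two_mul, pow_add, inv_pow, mul_inv_cancel_right₀ (pow_ne_zero n hz0)]
  rw [hrefl, norm_mul, norm_pow]
  refine mul_le_of_le_one_right (by positivity) (norm_joukowskiLift_le_one hp hb ?_)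
  rw [norm_inv]
  exact inv_le_one_of_one_le₀ hz

lemma norm_deriv_joukowskiLift_le {p : ℝ[X]} {n : ℕ} (hn : 0 < n) (hp : p.natDegree ≤ n)
    (hb : ∀ x ∈ Set.Icc (-1 : ℝ) 1, |p.eval x| ≤ 1) {z : ℂ} (hz : ‖z‖ = 1) :
    ‖deriv (joukowskiLift p n) z‖ ≤ 8 * n := by
  have hn' : (0 : ℝ) < n := Nat.cast_pos.mpr hn
  have hexp : (1 + 1 / (n : ℝ)) ^ (2 * n) ≤ 8 := by
    have hone : 1 + 1 / (n : ℝ) ≤ Real.exp (1 / n) := by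
      linarith [Real.add_one_le_exp (1 / (n : ℝ))]
    calc (1 + 1 / (n : ℝ)) ^ (2 * n) ≤ Real.exp (1 / n) ^ (2 * n) := by gcongr
      _ = Real.exp 1 ^ 2 := by
        rw [mul_comm 2 n, pow_mul, ← Real.exp_nat_mul, mul_one_div_cancel hn'.ne']
      _ ≤ 8 := by nlinarith [Real.exp_one_lt_d9, Real.exp_pos 1]
  have hbound := Complex.norm_deriv_le_of_forall_mem_sphere_norm_le (c := z) (R := 1 / n) (C := 8)
    (by positivity) (differentiable_joukowskiLift p n).diffContOnCl (fun w hw => ?_)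
  · simpa using hbound
  · rcases le_total ‖w‖ 1 with h | h
    · exact (norm_joukowskiLift_le_one hp hb h).trans (by norm_num)
    · refine (norm_joukowskiLift_le_pow hp hb h).trans (le_trans ?_ hexp)
      gcongr
      have := norm_add_le z (w - z)
      rw [mem_sphere_iff_norm] at hw
      rwa [add_sub_cancel, hz, hw] at this

/-- A Bernstein inequality for algebraic polynomials, in trigonometric form. -/
lemma abs_derivative_eval_cos_mul_sin_le {p : ℝ[X]} {n : ℕ} (hn : 0 < n) (hp : p.natDegree ≤ n)
    (hb : ∀ x ∈ Set.Icc (-1 : ℝ) 1, |p.eval x| ≤ 1) (θ : ℝ) :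
    |p.derivative.eval (Real.cos θ) * Real.sin θ| ≤ 9 * n := by
  set e : ℝ → ℂ := fun t => Complex.exp (t * Complex.I)
  have hnorm : ‖e θ‖ = 1 := Complex.norm_exp_ofReal_mul_I θ
  have hde : HasDerivAt e (e θ * Complex.I) θ := by
    have h : HasDerivAt (fun t : ℝ => (t : ℂ) * Complex.I) Complex.I θ := by
      simpa using (Complex.ofRealCLM.hasDerivAt (x := θ)).mul_const Complex.I
    exact h.cexp
  have hleft : HasDerivAt (fun t => joukowskiLift p n (e t))
      (deriv (joukowskiLift p n) (e θ) * (e θ * Complex.I)) θ :=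
    (differentiable_joukowskiLift p n (e θ)).hasDerivAt.comp θ hde
  have hright : HasDerivAt (fun t => e t ^ n * ((p.eval (Real.cos t) : ℝ) : ℂ))
      ((n * e θ ^ (n - 1) * (e θ * Complex.I)) * ((p.eval (Real.cos θ) : ℝ) : ℂ) +
        e θ ^ n * ((p.derivative.eval (Real.cos θ) * -Real.sin θ : ℝ) : ℂ)) θ :=
    (hde.pow n).mul ((p.hasDerivAt (Real.cos θ)).comp θ (Real.hasDerivAt_cos θ)).ofReal_comp
  have heq := (hleft.congr_of_eventuallyEq
    (Filter.Eventually.of_forall fun t => (joukowskiLift_exp hp t).symm)).unique hright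
  have hkey : e θ ^ n * ((p.derivative.eval (Real.cos θ) * -Real.sin θ : ℝ) : ℂ) =
      deriv (joukowskiLift p n) (e θ) * (e θ * Complex.I) -
      (n * e θ ^ (n - 1) * (e θ * Complex.I)) * ((p.eval (Real.cos θ) : ℝ) : ℂ) := by
    rw [heq]; ring
  have hle := norm_sub_le (deriv (joukowskiLift p n) (e θ) * (e θ * Complex.I))
    ((n * e θ ^ (n - 1) * (e θ * Complex.I)) * ((p.eval (Real.cos θ) : ℝ) : ℂ))
  rw [← hkey] at hle
  simp only [norm_mul, norm_pow, hnorm, one_pow, Complex.norm_real, Complex.norm_I, one_mul,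
    mul_one, Complex.norm_natCast, Real.norm_eq_abs, abs_neg] at hle
  rw [abs_mul]
  have h1 := norm_deriv_joukowskiLift_le hn hp hb hnorm
  have h2 := mul_le_of_le_one_right (Nat.cast_nonneg (α := ℝ) n) (hb _ (Real.cos_mem_Icc θ))
  linarith

/-- A Bernstein inequality on an arbitrary interval. -/
lemma derivative_eval_sq_mul_le {p : ℝ[X]} {n : ℕ} (hn : 0 < n) (hp : p.natDegree ≤ n)
    {a b : ℝ} (hab : a < b) (hb : ∀ x ∈ Set.Icc a b, |p.eval x| ≤ 1)
    {y : ℝ} (hy : y ∈ Set.Icc a b) :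
    p.derivative.eval y ^ 2 * ((y - a) * (b - y)) ≤ (9 * n) ^ 2 := by
  have hpos : 0 < (b - a) / 2 := by linarith
  set q : ℝ[X] := p.comp (C ((b - a) / 2) * X + C ((a + b) / 2)) with hq
  have hqdeg : q.natDegree ≤ n := by
    refine natDegree_comp_le.trans ?_
    calc p.natDegree * _ ≤ n * 1 := Nat.mul_le_mul hp natDegree_linear_le
      _ = n := mul_one n
  have hqb : ∀ x ∈ Set.Icc (-1 : ℝ) 1, |q.eval x| ≤ 1 := by
    rintro x ⟨hx1, hx2⟩
    simp only [hq, eval_comp, eval_add, eval_mul, eval_C, eval_X]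
    exact hb _ ⟨by nlinarith, by nlinarith⟩
  obtain ⟨hya, hyb⟩ := hy
  set u : ℝ := (y - (a + b) / 2) / ((b - a) / 2) with hu
  have huy : (b - a) / 2 * u + (a + b) / 2 = y := by
    rw [hu, mul_div_cancel₀ _ hpos.ne']; ring
  have hu1 : -1 ≤ u := by rw [hu, le_div_iff₀ hpos]; linarith
  have hu2 : u ≤ 1 := by rw [hu, div_le_one hpos]; linarith
  have hB := abs_derivative_eval_cos_mul_sin_le hn hqdeg hqb (Real.arccos u)
  rw [Real.cos_arccos hu1 hu2] at hB
  have hder : q.derivative.eval u = (b - a) / 2 * p.derivative.eval y := by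
    simp [hq, derivative_comp, huy]
  have hsq := sq_le_sq' (by linarith [(abs_le.mp hB).1]) (abs_le.mp hB).2
  rw [hder, mul_pow, Real.sin_arccos, Real.sq_sqrt (by nlinarith)] at hsq
  calc p.derivative.eval y ^ 2 * ((y - a) * (b - y))
      = ((b - a) / 2 * p.derivative.eval y) ^ 2 * (1 - u ^ 2) := by
        rw [← huy]; ring
    _ ≤ _ := hsq

/-- Bernoulli's inequality comparing two powers with tangent graphs at `0`. -/
lemma one_add_div_mul_pow_le {κ ν : ℕ} (hκ : 0 < κ) (hκν : κ ≤ ν) {s : ℝ}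
    (hs : 0 ≤ 1 + (ν / κ : ℝ) * s) : (1 + (ν / κ : ℝ) * s) ^ κ ≤ (1 + s) ^ ν := by
  have hκ' : (0 : ℝ) < κ := Nat.cast_pos.mpr hκ
  have hκν' : (κ : ℝ) ≤ ν := Nat.cast_le.mpr hκν
  have hratio : 1 ≤ (ν / κ : ℝ) := (one_le_div hκ').mpr hκν'
  have hs1 : -1 ≤ s := by
    by_contra! h
    nlinarith
  calc (1 + (ν / κ : ℝ) * s) ^ κ ≤ ((1 + s) ^ (ν / κ : ℝ)) ^ κ :=
        pow_le_pow_left₀ hs (one_add_mul_self_le_rpow_one_add hs1 hratio) κ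
    _ = (1 + s) ^ ν := by
        rw [← Real.rpow_mul_natCast (by linarith), div_mul_cancel₀ _ hκ'.ne', Real.rpow_natCast]

/-- A Bernstein inequality for the Müntz space `span {x ^ ν, …, x ^ (ν + κ)}` on `[0, 1]`. -/
lemma derivative_eval_X_pow_mul_sq_le {κ ν : ℕ} (hκ : 0 < κ) (hκν : κ ≤ ν) {Q : ℝ[X]}
    (hQ : Q.natDegree ≤ κ) (hb : ∀ x ∈ Set.Icc (0 : ℝ) 1, |(X ^ ν * Q).eval x| ≤ 1)
    {y : ℝ} (hy : y ∈ Set.Icc (0 : ℝ) 1) :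
    (X ^ ν * Q).derivative.eval y ^ 2 * (y * (1 - y)) ≤ 324 * (κ * ν) := by
  obtain ⟨hy0, hy1⟩ := hy
  rcases hy0.eq_or_lt with rfl | hy0
  · simp only [zero_mul, mul_zero]; positivity
  have hκ' : (0 : ℝ) < κ := Nat.cast_pos.mpr hκ
  have hκν' : (κ : ℝ) ≤ ν := Nat.cast_le.mpr hκν
  have hν' : (0 : ℝ) < ν := hκ'.trans_le hκν'
  set r : ℝ := ν / κ with hr
  have hr1 : 1 ≤ r := (one_le_div hκ').mpr hκν'
  have hrpos : 0 < r := one_pos.trans_le hr1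
  -- The polynomial `P` is tangent to `x ^ ν` at `y` and lies below it on `[a, 1]`.
  set P : ℝ[X] := C (y ^ ν) * (C (r / y) * X + C (1 - r)) ^ κ with hP
  have hPeval (x : ℝ) : P.eval x = y ^ ν * (1 + r * ((x - y) / y)) ^ κ := by
    simp only [hP, eval_mul, eval_pow, eval_add, eval_C, eval_X]
    congr 2
    field_simp
    ring
  have hPy : P.eval y = y ^ ν := by simp [hPeval]
  have hPder : P.derivative.eval y = ν * y ^ (ν - 1) := by
    have hlin : r / y * y + (1 - r) = 1 := by field_simp; ring
    have hpow : y ^ ν = y ^ (ν - 1) * y := by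
      rw [← pow_succ, Nat.sub_add_cancel (hκ.trans_le hκν)]
    simp only [hP, derivative_mul, derivative_C, derivative_pow, derivative_add, derivative_X,
      eval_mul, eval_pow, eval_add, eval_C, eval_X, hlin,
      one_pow, zero_mul, zero_add, mul_one, add_zero]
    rw [hpow, hr]
    field_simp
  have hdeg : (P * Q).natDegree ≤ 2 * κ := by
    refine natDegree_mul_le.trans ?_
    have : P.natDegree ≤ κ := by
      refine (natDegree_C_mul_le _ _).trans (natDegree_pow_le.trans ?_)
      exact (Nat.mul_le_mul le_rfl natDegree_linear_le).trans (mul_one κ).le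
    omega
  set a : ℝ := y - y / r with ha
  have hyr : y / r ≤ y := div_le_self hy0.le hr1
  have hyr0 : 0 < y / r := div_pos hy0 hrpos
  have hPQ : ∀ x ∈ Set.Icc a 1, |(P * Q).eval x| ≤ 1 := by
    rintro x ⟨hxa, hx1⟩
    have hs : 0 ≤ 1 + r * ((x - y) / y) := by
      have : -(y / r) ≤ x - y := by linarith
      have h2 : r / y * -(y / r) ≤ r / y * (x - y) := by gcongr
      have h3 : r / y * -(y / r) = -1 := by field_simp
      have h4 : r * ((x - y) / y) = r / y * (x - y) := by ring
      linarith
    have hle : P.eval x ≤ x ^ ν := by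
      rw [hPeval]
      calc y ^ ν * (1 + r * ((x - y) / y)) ^ κ ≤ y ^ ν * (1 + (x - y) / y) ^ ν := by
            gcongr
            exact one_add_div_mul_pow_le hκ hκν hs
        _ = x ^ ν := by
            rw [← mul_pow]
            congr 1
            field_simp
            ring
    have hP0 : 0 ≤ P.eval x := by rw [hPeval]; positivity
    have hbx := hb x ⟨by linarith, hx1⟩
    rw [eval_mul, abs_mul, abs_of_nonneg hP0]
    rw [eval_mul, abs_mul, eval_pow, eval_X, abs_of_nonneg (hP0.trans hle)] at hbx
    exact (mul_le_mul_of_nonneg_right hle (abs_nonneg _)).trans hbx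
  have hder : (P * Q).derivative.eval y = (X ^ ν * Q).derivative.eval y := by
    simp [derivative_mul, derivative_X_pow, hPy, hPder]
  rcases hy1.eq_or_lt with rfl | hy1
  · simp only [sub_self, mul_zero]; positivity
  have hB := derivative_eval_sq_mul_le (by omega) hdeg (by linarith) hPQ
    ⟨by linarith, hy1.le⟩
  rw [hder, ha, sub_sub_cancel] at hB
  calc _ = r * ((X ^ ν * Q).derivative.eval y ^ 2 * (y / r * (1 - y))) := by field_simp
    _ ≤ r * (9 * (2 * κ : ℕ)) ^ 2 := by gcongr
    _ = 324 * (κ * ν) := by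
      rw [hr]; push_cast; field_simp; ring

lemma abs_sub_comp_cos_sq_le {κ ν : ℕ} (hκ : 0 < κ) (hκν : κ ≤ ν) {Q : ℝ[X]}
    (hQ : Q.natDegree ≤ κ) (hb : ∀ x ∈ Set.Icc (0 : ℝ) 1, |(X ^ ν * Q).eval x| ≤ 1) (s t : ℝ) :
    |(X ^ ν * Q).eval (Real.cos t ^ 2) - (X ^ ν * Q).eval (Real.cos s ^ 2)| ≤
      36 * √(κ * ν) * |t - s| := by
  set T : ℝ[X] := X ^ ν * Q
  have hder (φ : ℝ) : HasDerivAt (fun φ => T.eval (Real.cos φ ^ 2))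
      (T.derivative.eval (Real.cos φ ^ 2) * (2 * Real.cos φ * -Real.sin φ)) φ := by
    have h := (Real.hasDerivAt_cos φ).pow 2
    simp only [Nat.cast_ofNat, Nat.add_one_sub_one, pow_one] at h
    exact (T.hasDerivAt (Real.cos φ ^ 2)).comp φ h
  refine Convex.norm_image_sub_le_of_norm_hasDerivWithin_le
    (fun φ _ => (hder φ).hasDerivWithinAt) (fun φ _ => ?_) convex_univ
    (Set.mem_univ s) (Set.mem_univ t)
  have hB := derivative_eval_X_pow_mul_sq_le hκ hκν hQ hb (y := Real.cos φ ^ 2)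
    ⟨by positivity, Real.cos_sq_le_one φ⟩
  rw [← Real.sin_sq] at hB
  refine abs_le_of_sq_le_sq ?_ (by positivity)
  rw [mul_pow, mul_pow 36, Real.sq_sqrt (by positivity)]
  nlinarith

/-- Points at which a Lipschitz function takes the values `±1` alternately are separated. -/
lemma add_mul_le_of_alternating {F : ℝ → ℝ} {h : ℝ} (hh : 0 < h)
    (hlip : ∀ s t, |F t - F s| ≤ 2 / h * |t - s|) {κ : ℕ} {φ : ℕ → ℝ}
    (hmono : ∀ j < κ, φ j ≤ φ (j + 1)) (hF : ∀ j ≤ κ, F (φ j) = (-1) ^ j)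
    {i j : ℕ} (hij : i ≤ j) (hj : j ≤ κ) : φ i + (j - i) * h ≤ φ j := by
  induction j, hij using Nat.le_induction with
  | base => simp
  | succ j hij ih =>
    have hgap : h ≤ φ (j + 1) - φ j := by
      have hL := hlip (φ j) (φ (j + 1))
      rw [hF j (by omega), hF (j + 1) hj, abs_of_nonneg (sub_nonneg.mpr (hmono j hj)),
        show (-1 : ℝ) ^ (j + 1) - (-1) ^ j = -2 * (-1) ^ j by ring, abs_mul, abs_neg_one_pow,
        div_mul_eq_mul_div, le_div_iff₀ hh] at hL
      norm_num at hL
      linarith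
    have := ih (by omega)
    push_cast
    linarith

lemma mul_div_le_two_mul_sin_mul_cos {h φ a b : ℝ} (hh : 0 ≤ h) (ha : 0 ≤ a) (hb : 0 ≤ b)
    (hab : 0 < a + b) (haφ : a * h / 2 ≤ φ) (hbφ : b * h / 2 ≤ Real.pi / 2 - φ) :
    h * (a * b) / (2 * (a + b)) ≤ 2 * Real.sin φ * Real.cos φ := by
  have hπ := Real.pi_pos
  have hφ0 : 0 ≤ φ := le_trans (by positivity) haφ
  have hφ1 : 0 ≤ Real.pi / 2 - φ := le_trans (by positivity) hbφ
  have hsin := Real.mul_le_sin hφ0 (by linarith)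
  have hcos := Real.mul_le_sin hφ1 (by linarith)
  rw [Real.sin_pi_div_two_sub] at hcos
  have hprod : Real.pi / 2 * (h / 2) * (a * b) ≤ φ * (Real.pi / 2 - φ) * (a + b) := by
    nlinarith [mul_nonneg (mul_nonneg hφ0 ha) (sub_nonneg.mpr hbφ),
      mul_nonneg (mul_nonneg hφ1 hb) (sub_nonneg.mpr haφ)]
  calc h * (a * b) / (2 * (a + b))
      ≤ 2 / Real.pi * (h * (a * b) / (a + b)) := by
        rw [mul_comm 2 (a + b), ← div_div, div_eq_mul_inv _ (2 : ℝ), mul_comm]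
        gcongr
        rw [inv_eq_one_div, div_le_div_iff₀ two_pos hπ]
        linarith [Real.pi_le_four]
    _ = 8 / Real.pi ^ 2 * (Real.pi / 2 * (h / 2) * (a * b) / (a + b)) := by
        field_simp; ring
    _ ≤ 8 / Real.pi ^ 2 * (φ * (Real.pi / 2 - φ)) := by
        gcongr
        rwa [div_le_iff₀ hab]
    _ = 2 * (2 / Real.pi * φ) * (2 / Real.pi * (Real.pi / 2 - φ)) := by field_simp; ring
    _ ≤ 2 * Real.sin φ * Real.cos φ := by
        have : 0 ≤ Real.sin φ := le_trans (by positivity) hsin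
        gcongr

lemma sum_range_mul_sub (κ : ℕ) :
    ∑ j ∈ Finset.range κ, (j : ℝ) * (κ - j) = κ * (κ ^ 2 - 1) / 6 := by
  have h (c : ℝ) (n : ℕ) : ∑ j ∈ Finset.range n, (j : ℝ) * (c - j) =
      c * (n * (n - 1) / 2) - (n - 1) * n * (2 * n - 1) / 6 := by
    induction n with
    | zero => simp
    | succ n ih => rw [Finset.sum_range_succ, ih]; push_cast; ring
  rw [h]; ring

/-- A Lipschitz function taking the values `±1` alternately at `κ + 1` points of `[0, π / 2]` has
a large square integral against `sin (2 φ)`. -/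
lemma le_integral_sq_mul_of_alternating {F : ℝ → ℝ} (hcont : Continuous F) {h : ℝ} (hh : 0 < h)
    (hlip : ∀ s t, |F t - F s| ≤ 2 / h * |t - s|) {κ : ℕ} (hκ : 2 ≤ κ) {φ : ℕ → ℝ}
    (hφ0 : 0 ≤ φ 0) (hφκ : φ κ ≤ Real.pi / 2)
    (hmono : ∀ j < κ, φ j ≤ φ (j + 1)) (hF : ∀ j ≤ κ, F (φ j) = (-1) ^ j) :
    h ^ 2 * κ ^ 2 / 256 ≤
      ∫ t in (0 : ℝ)..Real.pi / 2, F t ^ 2 * (2 * Real.sin t * Real.cos t) := by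
  have hκ' : (2 : ℝ) ≤ κ := by exact_mod_cast hκ
  set g : ℝ → ℝ := fun t => F t ^ 2 * (2 * Real.sin t * Real.cos t) with hg
  have hgc : Continuous g := by fun_prop
  have hsep {i j : ℕ} (hij : i ≤ j) (hj : j ≤ κ) : φ i + (j - i) * h ≤ φ j :=
    add_mul_le_of_alternating hh hlip hmono hF hij hj
  have hg0 : ∀ t, 0 ≤ t → t ≤ Real.pi / 2 → 0 ≤ g t := fun t h0 h1 => by
    have := Real.sin_nonneg_of_nonneg_of_le_pi h0 (by linarith [Real.pi_pos])
    have := Real.cos_nonneg_of_neg_pi_div_two_le_of_le (by linarith [Real.pi_pos]) h1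
    positivity
  have hmem {j : ℕ} (hj : j ≤ κ) : 0 ≤ φ j ∧ φ j ≤ Real.pi / 2 := by
    have h1 := hsep (Nat.zero_le j) hj
    have h2 := hsep hj le_rfl
    have h3 : (0 : ℝ) ≤ κ - j := sub_nonneg.mpr (by exact_mod_cast hj)
    push_cast at h1
    exact ⟨le_trans (by rw [sub_zero]; positivity) h1,
      by linarith [mul_nonneg h3 hh.le]⟩
  have hpiece : ∀ j ∈ Finset.range κ,
      h ^ 2 / (32 * κ) * (j * (κ - j)) ≤ ∫ t in φ j..φ (j + 1), g t := by
    intro j hj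
    rw [Finset.mem_range] at hj
    have hjκ : (j : ℝ) + 1 ≤ κ := by exact_mod_cast hj
    have hgap := hsep (Nat.le_succ j) hj
    have hlow := hsep (Nat.zero_le j) hj.le
    have hhigh := hsep hj.le le_rfl
    push_cast at hgap hlow
    have hlower : ∀ t ∈ Set.Icc (φ j) (φ j + h / 4),
        h * (j * (κ - j)) / (8 * κ) ≤ g t := by
      rintro t ⟨ht1, ht2⟩
      have hFt : 1 / 4 ≤ F t ^ 2 := by
        have hd := hlip (φ j) t
        rw [hF j hj.le, abs_of_nonneg (sub_nonneg.mpr ht1)] at hd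
        have hhalf : 2 / h * (t - φ j) ≤ 1 / 2 := by
          rw [div_mul_eq_mul_div, div_le_iff₀ hh]; linarith
        have h1 := abs_sub_abs_le_abs_sub ((-1 : ℝ) ^ j) (F t)
        rw [abs_neg_one_pow, abs_sub_comm] at h1
        have h2 : 1 / 2 ≤ |F t| := by linarith
        rw [← sq_abs]
        nlinarith
      have hw := mul_div_le_two_mul_sin_mul_cos (h := h) (φ := t) (a := j) (b := κ - j) hh.le
        (Nat.cast_nonneg j) (by linarith) (by linarith)
        (by nlinarith [Nat.cast_nonneg (α := ℝ) j]) (by nlinarith)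
      rw [add_sub_cancel] at hw
      have hjk : 0 ≤ (j : ℝ) * (κ - j) := mul_nonneg (Nat.cast_nonneg j) (by linarith)
      calc h * (j * (κ - j)) / (8 * κ) = 1 / 4 * (h * (j * (κ - j)) / (2 * κ)) := by
            field_simp; ring
        _ ≤ g t := mul_le_mul hFt hw (by positivity) (sq_nonneg _)
    calc h ^ 2 / (32 * κ) * (j * (κ - j))
        = ∫ t in φ j..φ j + h / 4, h * (j * (κ - j)) / (8 * κ) := by
          rw [intervalIntegral.integral_const, smul_eq_mul, add_sub_cancel_left]
          field_simp; ring
      _ ≤ ∫ t in φ j..φ j + h / 4, g t :=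
          intervalIntegral.integral_mono_on (by linarith) (by simp)
            (hgc.intervalIntegrable _ _) hlower
      _ ≤ ∫ t in φ j..φ (j + 1), g t := by
          refine intervalIntegral.integral_mono_interval le_rfl (by linarith) (by linarith) ?_
            (hgc.intervalIntegrable _ _)
          refine MeasureTheory.ae_restrict_of_forall_mem measurableSet_Ioc fun t ht => ?_
          exact hg0 t ((hmem hj.le).1.trans ht.1.le) (ht.2.trans (hmem hj).2)
  calc h ^ 2 * κ ^ 2 / 256 ≤ h ^ 2 * ((κ ^ 2 - 1) / 192) := by
        rw [mul_div_assoc]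
        refine mul_le_mul_of_nonneg_left ?_ (sq_nonneg h)
        nlinarith
    _ = ∑ j ∈ Finset.range κ, h ^ 2 / (32 * κ) * (j * (κ - j)) := by
        rw [← Finset.mul_sum, sum_range_mul_sub]; field_simp; ring
    _ ≤ ∑ j ∈ Finset.range κ, ∫ t in φ j..φ (j + 1), g t := Finset.sum_le_sum hpiece
    _ = ∫ t in φ 0..φ κ, g t :=
        intervalIntegral.sum_integral_adjacent_intervals fun _ _ => hgc.intervalIntegrable _ _
    _ ≤ ∫ t in (0 : ℝ)..Real.pi / 2, g t := by
        refine intervalIntegral.integral_mono_interval hφ0 ?_ hφκ ?_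
          (hgc.intervalIntegrable _ _)
        · have := hsep (Nat.zero_le κ) le_rfl
          push_cast at this
          nlinarith
        · refine MeasureTheory.ae_restrict_of_forall_mem measurableSet_Ioc fun t ht => ?_
          exact hg0 t ht.1.le ht.2

lemma integral_eq_integral_comp_cos_sq {f : ℝ → ℝ} (hf : Continuous f) :
    ∫ u in (0 : ℝ)..1, f u =
      ∫ t in (0 : ℝ)..Real.pi / 2, f (Real.cos t ^ 2) * (2 * Real.sin t * Real.cos t) := by
  have hder (t : ℝ) : HasDerivAt (fun t => Real.cos t ^ 2) (-(2 * Real.sin t * Real.cos t)) t := by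
    refine ((Real.hasDerivAt_cos t).pow 2).congr_deriv ?_
    push_cast
    ring
  have h := intervalIntegral.integral_comp_mul_deriv (a := 0) (b := Real.pi / 2)
    (fun t _ => hder t) (by fun_prop) hf
  simp only [Function.comp_apply, mul_neg, intervalIntegral.integral_neg, Real.cos_zero,
    Real.cos_pi_div_two, one_pow, ne_eq, OfNat.ofNat_ne_zero, not_false_eq_true, zero_pow] at h
  rw [intervalIntegral.integral_symm, ← h, neg_neg]

/-- There is an absolute constant `c₅ > 0` such that for integers `κ ≥ 2`,
`ν ≥ 20κ`, if `T` is the Chebyshev polynomial of the Müntz space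
`span{x^ν, …, x^(ν+κ)}` on `[0,1]` normalized so `T(1) = 1` (i.e. `T = x^ν Q` with
`deg Q ≤ κ`, `‖T‖_{[0,1]} = 1`, and `T` equioscillates at points
`1 = x_0 > … > x_κ > 0`), then `∫_0^1 T(u)² du ≥ c₅ κ/ν`. -/
theorem stmt_12 : ∃ c₅ : ℝ, 0 < c₅ ∧ ∀ ν κ : ℕ, 2 ≤ κ → 20 * κ ≤ ν →
    ∀ T Q : Polynomial ℝ, Q.natDegree ≤ κ → T = X ^ ν * Q → T.eval 1 = 1 →
    (⨆ x : Set.Icc (0:ℝ) 1, |T.eval (x : ℝ)|) = 1 →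
    (∃ x : ℕ → ℝ, x 0 = 1 ∧ (∀ i j : ℕ, i < j → j ≤ κ → x j < x i) ∧ 0 < x κ ∧
      ∀ j ≤ κ, T.eval (x j) = (-1 : ℝ) ^ j) →
    c₅ * (κ : ℝ) / (ν : ℝ) ≤ ∫ u in (0:ℝ)..1, (T.eval u) ^ 2 := by
  refine ⟨1 / 82944, by norm_num, ?_⟩
  rintro ν κ hκ hν T Q hQ rfl - hsup ⟨x, hx0, hanti, hxκ, halt⟩
  have hb : ∀ u ∈ Set.Icc (0 : ℝ) 1, |(X ^ ν * Q).eval u| ≤ 1 := by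
    intro u hu
    have hbdd : BddAbove (Set.range fun u : Set.Icc (0 : ℝ) 1 => |(X ^ ν * Q).eval (u : ℝ)|) :=
      (isCompact_range (by fun_prop)).bddAbove
    exact hsup ▸ le_ciSup hbdd ⟨u, hu⟩
  have hκpos : 0 < κ := by omega
  have hκ' : (0 : ℝ) < κ := Nat.cast_pos.mpr hκpos
  have hν' : (0 : ℝ) < ν := Nat.cast_pos.mpr (by omega)
  have hx_pos : ∀ j ≤ κ, 0 < x j := fun j hj => by
    rcases hj.eq_or_lt with rfl | hj
    · exact hxκ
    · exact hxκ.trans (hanti j κ hj le_rfl)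
  have hx_le : ∀ j ≤ κ, x j ≤ 1 := fun j hj => by
    rcases (Nat.zero_le j).eq_or_lt with rfl | hj0
    · exact hx0.le
    · exact hx0 ▸ (hanti 0 j hj0 hj).le
  have hcos : ∀ j ≤ κ, Real.cos (Real.arccos √(x j)) ^ 2 = x j := fun j hj => by
    rw [Real.cos_arccos (by linarith [Real.sqrt_nonneg (x j)])
      (Real.sqrt_le_one.mpr (hx_le j hj)), Real.sq_sqrt (hx_pos j hj).le]
  have hsqrt : 0 < √((κ : ℝ) * ν) := Real.sqrt_pos.mpr (by positivity)
  have hmain := le_integral_sq_mul_of_alternating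
    (F := fun t => (X ^ ν * Q).eval (Real.cos t ^ 2)) (by fun_prop)
    (h := 1 / (18 * √((κ : ℝ) * ν))) (by positivity)
    (fun s t => by
      convert abs_sub_comp_cos_sq_le hκpos (by omega) hQ hb s t using 2
      field_simp; norm_num)
    hκ (φ := fun j => Real.arccos √(x j)) (Real.arccos_nonneg _)
    (Real.arccos_le_pi_div_two.mpr (Real.sqrt_nonneg _))
    (fun j hj => Real.arccos_le_arccos (Real.sqrt_le_sqrt (hanti j (j + 1) j.lt_succ_self hj).le))
    (fun j hj => by simp only [hcos j hj, halt j hj])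
  rw [integral_eq_integral_comp_cos_sq (f := fun u : ℝ => (X ^ ν * Q : ℝ[X]).eval u ^ 2) (by fun_prop)]
  refine le_trans (le_of_eq ?_) hmain
  rw [div_pow, mul_pow, Real.sq_sqrt (by positivity)]
  field_simp
  norm_num
end
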